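/- Let d ≥ 0, let (λ_{ij})_{0≤i,j≤d} be scalars in K, and let a := 1 + Σ_{0≤i,j≤d} λ_{ij}·E_{ij} ∈ I_1, where E_{ij} ∈ End_K(K[x]) is the matrix unit defined by E_{ij}(x^s) = x^i if s = j and E_{ij}(x^s) = 0 otherwise. Then a is a unit of I_1 if and only if the determinant of the (d+1)×(d+1) matrix Id + (λ_{ij}) over K is nonzero. -/

import Mathlib

set_option linter.unusedSectionVars false

open Polynomial

noncomputable section

variable (K : Type*) [Field K] [CharZero K]

/-- Formal differentiation `∂` as a `K`-linear endomorphism of `K[x]`. -/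
def derOp : Module.End K (Polynomial K) := Polynomial.derivative

/-- Multiplication by `x` as a `K`-linear endomorphism of `K[x]`. -/
def xOp : Module.End K (Polynomial K) := LinearMap.mulLeft K (Polynomial.X : Polynomial K)

/-- Integration `∫`: the unique `K`-linear map with `∫ xⁿ = xⁿ⁺¹/(n+1)`. -/
def intOp : Module.End K (Polynomial K) :=
  Polynomial.lsum fun n => ((n : K) + 1)⁻¹ • Polynomial.monomial (n + 1)

/-- The algebra `I₁` of polynomial integro-differential operators: the unital
`K`-subalgebra of `End_K K[x]` generated by `X`, `∂` and `∫`. -/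
def I1 : Subalgebra K (Module.End K (Polynomial K)) :=
  Algebra.adjoin K {xOp K, derOp K, intOp K}

/-- `H := ∂ ∘ X`. -/
def Hop : Module.End K (Polynomial K) := derOp K * xOp K

/-- `e_{ij} := ∫^i ∂^j - ∫^{i+1} ∂^{j+1}`. -/
def eOp (i j : ℕ) : Module.End K (Polynomial K) :=
  intOp K ^ i * derOp K ^ j - intOp K ^ (i + 1) * derOp K ^ (j + 1)

/-- `F`, the `K`-linear span of the `e_{ij}`. -/
def Fspan : Submodule K (Module.End K (Polynomial K)) :=
  Submodule.span K (Set.range fun p : ℕ × ℕ => eOp K p.1 p.2)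

lemma xOp_mem : xOp K ∈ I1 K := Algebra.subset_adjoin (by simp)
lemma derOp_mem : derOp K ∈ I1 K := Algebra.subset_adjoin (by simp)
lemma intOp_mem : intOp K ∈ I1 K := Algebra.subset_adjoin (by simp)
lemma Hop_mem : Hop K ∈ I1 K := mul_mem (derOp_mem K) (xOp_mem K)
lemma eOp_mem (i j : ℕ) : eOp K i j ∈ I1 K :=
  sub_mem (mul_mem (pow_mem (intOp_mem K) i) (pow_mem (derOp_mem K) j))
    (mul_mem (pow_mem (intOp_mem K) (i + 1)) (pow_mem (derOp_mem K) (j + 1)))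

/-- `H` as an element of `I₁`. -/
def HelI : I1 K := ⟨Hop K, Hop_mem K⟩
/-- `∂` as an element of `I₁`. -/
def DelI : I1 K := ⟨derOp K, derOp_mem K⟩
/-- `∫` as an element of `I₁`. -/
def IntI : I1 K := ⟨intOp K, intOp_mem K⟩

set_option synthInstance.maxHeartbeats 400000
set_option maxHeartbeats 1000000

/-- The matrix unit `E_{ij} ∈ End_K K[x]`, `E_{ij}(xˢ) = δ_{js} xⁱ`. -/
def Eop (i j : ℕ) : Module.End K (Polynomial K) :=
  (Polynomial.monomial i).comp (Polynomial.lcoeff K j)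

lemma aux_E00 : Eop K 0 0 = 1 - intOp K * derOp K := by
  apply Polynomial.lhom_ext'
  intro n
  ext1
  simp only [Eop, intOp, derOp, LinearMap.comp_apply, LinearMap.sub_apply, Module.End.mul_apply,
    Module.End.one_apply, Polynomial.lcoeff_apply, Polynomial.derivative_monomial,
    Polynomial.lsum_apply, Polynomial.coeff_monomial]
  rcases n with _ | n
  · simp
  · have h : (n : K) + 1 ≠ 0 := by exact_mod_cast Nat.succ_ne_zero n
    rw [Polynomial.sum_monomial_index _ _ (by simp)]
    simp only [Nat.add_sub_cancel, LinearMap.smul_apply, Polynomial.smul_monomial, smul_eq_mul]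
    rw [one_mul, Nat.cast_add, Nat.cast_one, inv_mul_cancel₀ h]
    simp

lemma aux_E (i j : ℕ) :
    Eop K i j = ((j.factorial : K))⁻¹ • (xOp K ^ i * Eop K 0 0 * derOp K ^ j) := by
  have hj : (j.factorial : K) ≠ 0 := by exact_mod_cast j.factorial_ne_zero
  apply LinearMap.ext
  intro p
  have hx : ∀ (i : ℕ) (q : Polynomial K), (xOp K ^ i) q = Polynomial.X ^ i * q := by
    intro i
    induction i with
    | zero => intro q; simp
    | succ i ih => intro q; rw [pow_succ, Module.End.mul_apply, ih, xOp]; simp [pow_succ, mul_assoc]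
  have hd : (derOp K ^ j) p = Polynomial.derivative^[j] p := by
    rw [Module.End.pow_apply]; rfl
  rw [LinearMap.smul_apply, Module.End.mul_apply, Module.End.mul_apply, hx, hd]
  simp only [Eop, LinearMap.comp_apply, Polynomial.lcoeff_apply,
    Polynomial.coeff_iterate_derivative, zero_add, Nat.descFactorial_self]
  rw [Polynomial.X_pow_mul_monomial, Polynomial.smul_monomial]
  simp [hj]

lemma aux_E_mem (i j : ℕ) : Eop K i j ∈ I1 K := by
  rw [aux_E, aux_E00]
  exact Subalgebra.smul_mem _ (mul_mem (mul_mem (pow_mem (xOp_mem K) i)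
    (sub_mem (one_mem _) (mul_mem (intOp_mem K) (derOp_mem K)))) (pow_mem (derOp_mem K) j)) _

/-- The finite matrix as an operator. -/
def auxT (d : ℕ) (M : Matrix (Fin (d + 1)) (Fin (d + 1)) K) : Module.End K (Polynomial K) :=
  ∑ i : Fin (d + 1), ∑ j : Fin (d + 1), M i j • Eop K (i : ℕ) (j : ℕ)

lemma auxT_mem (d : ℕ) (M : Matrix (Fin (d + 1)) (Fin (d + 1)) K) : auxT K d M ∈ I1 K :=
  sum_mem fun i _ => sum_mem fun j _ => Subalgebra.smul_mem _ (aux_E_mem K i j) _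

lemma auxT_apply (d : ℕ) (M : Matrix (Fin (d + 1)) (Fin (d + 1)) K) (p : Polynomial K) :
    auxT K d M p = ∑ i : Fin (d + 1),
      Polynomial.monomial (i : ℕ) (M.mulVec (fun j => p.coeff j) i) := by
  simp [auxT, Eop, LinearMap.sum_apply, Matrix.mulVec, dotProduct, Polynomial.smul_monomial]

lemma aux_coeff (d : ℕ) (v : Fin (d + 1) → K) (j : Fin (d + 1)) :
    (∑ i : Fin (d + 1), Polynomial.monomial (i : ℕ) (v i)).coeff (j : ℕ) = v j := by
  simp [Polynomial.finsetSum_coeff, Polynomial.coeff_monomial, Fin.val_inj]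

lemma auxT_add (d : ℕ) (M N : Matrix (Fin (d + 1)) (Fin (d + 1)) K) :
    auxT K d (M + N) = auxT K d M + auxT K d N := by
  simp [auxT, add_smul, Finset.sum_add_distrib]

lemma auxT_mul (d : ℕ) (M N : Matrix (Fin (d + 1)) (Fin (d + 1)) K) :
    auxT K d M * auxT K d N = auxT K d (M * N) := by
  apply LinearMap.ext
  intro p
  rw [Module.End.mul_apply, auxT_apply, auxT_apply, auxT_apply]
  simp only [aux_coeff, ← Matrix.mulVec_mulVec]

lemma auxT_inv (d : ℕ) (M N : Matrix (Fin (d + 1)) (Fin (d + 1)) K)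
    (h : (1 + M) * (1 + N) = 1) : (1 + auxT K d M) * (1 + auxT K d N) = 1 := by
  have h0 : M + N + M * N = 0 := by
    have : M + N + M * N = (1 + M) * (1 + N) - 1 := by noncomm_ring
    rw [this, h, sub_self]
  have : (1 + auxT K d M) * (1 + auxT K d N) = 1 + auxT K d (M + N + M * N) := by
    rw [auxT_add, auxT_add, ← auxT_mul]; noncomm_ring
  rw [this, h0]
  simp [auxT]

/-- For scalars `(λ_{ij})_{0 ≤ i,j ≤ d}`, the element
`a = 1 + Σ λ_{ij} E_{ij}` is a unit of `I₁` iff `det (Id + (λ_{ij})) ≠ 0`. -/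
theorem one_add_matrix_unit_combination_is_unit_iff_det_ne_zero
    (d : ℕ) (lam : Fin (d + 1) → Fin (d + 1) → K) :
    ((1 + ∑ i : Fin (d + 1), ∑ j : Fin (d + 1), lam i j • Eop K (i : ℕ) (j : ℕ) ∈ I1 K) ∧
      ∃ b ∈ I1 K,
        (1 + ∑ i : Fin (d + 1), ∑ j : Fin (d + 1), lam i j • Eop K (i : ℕ) (j : ℕ)) * b = 1 ∧
        b * (1 + ∑ i : Fin (d + 1), ∑ j : Fin (d + 1), lam i j • Eop K (i : ℕ) (j : ℕ)) = 1) ↔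
      Matrix.det (1 + Matrix.of lam) ≠ 0 := by
  change ((1 + auxT K d (Matrix.of lam) ∈ I1 K) ∧ ∃ b ∈ I1 K,
    (1 + auxT K d (Matrix.of lam)) * b = 1 ∧ b * (1 + auxT K d (Matrix.of lam)) = 1) ↔ _
  generalize Matrix.of lam = M
  constructor
  · rintro ⟨-, b, -, -, hb⟩ hdet
    obtain ⟨v, hv, hMv⟩ := Matrix.exists_mulVec_eq_zero_iff.mpr hdet
    apply hv
    set p : Polynomial K := ∑ i : Fin (d + 1), Polynomial.monomial (i : ℕ) (v i) with hp
    have hap : (1 + auxT K d M) p = 0 := by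
      rw [LinearMap.add_apply, auxT_apply, Module.End.one_apply]
      have hc : (fun j : Fin (d + 1) => p.coeff (j : ℕ)) = v := funext fun j => aux_coeff K d v j
      rw [hc, hp, ← Finset.sum_add_distrib]
      refine Finset.sum_eq_zero fun i _ => ?_
      have := congrFun hMv i
      rw [Matrix.add_mulVec, Matrix.one_mulVec] at this
      rw [← map_add]
      have h2 : v i + M.mulVec v i = 0 := this
      rw [h2, map_zero]
    have hp0 : p = 0 := by
      have := LinearMap.congr_fun hb p
      rw [Module.End.mul_apply, hap, map_zero] at this
      exact this.symm
    funext j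
    rw [← aux_coeff K d v j, ← hp, hp0]
    simp
  · intro hdet
    have hu : IsUnit (1 + M).det := isUnit_iff_ne_zero.mpr hdet
    refine ⟨add_mem (one_mem _) (auxT_mem K d M), 1 + auxT K d ((1 + M)⁻¹ - 1),
      add_mem (one_mem _) (auxT_mem K d _), auxT_inv K d _ _ ?_, auxT_inv K d _ _ ?_⟩
    · rw [add_sub_cancel, Matrix.mul_nonsing_inv _ hu]
    · rw [add_sub_cancel, Matrix.nonsing_inv_mul _ hu]

end
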